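/- Let D be a positive integer that is not a perfect square and let P ∈ ℚ[X] be a polynomial of degree at least 1. Then the sequence (ℓ(√D · P(n)))_{n≥0} of period lengths of the continued fractions of the quadratic numbers √D · P(n) is unbounded. -/

import Mathlib

open Polynomial Filter

/-- The Gauss map used to generate the continued fraction expansion of a real number. -/
noncomputable def cfMap (x : ℝ) : ℝ := if Int.fract x = 0 then 0 else (Int.fract x)⁻¹

/-- The `i`-th partial quotient `a_i(x)` of the continued fraction expansion of `x`. -/
noncomputable def cfa (x : ℝ) (i : ℕ) : ℤ := ⌊cfMap^[i] x⌋

/-- The minimal eventual period length `ℓ(x)` of the continued fraction expansion of `x`,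
with the convention `ℓ(x) = 0` for rational `x`. -/
noncomputable def periodLength (x : ℝ) : ℕ :=
  open scoped Classical in
  if Irrational x then sInf {p : ℕ | 0 < p ∧ ∃ N : ℕ, ∀ n ≥ N, cfa x (n + p) = cfa x n} else 0

theorem cfMap_eq_inv_fract (x : ℝ) : cfMap x = (Int.fract x)⁻¹ := by
  unfold cfMap
  split_ifs with h <;> simp [h]

theorem fract_pos_of_irrational {x : ℝ} (hx : Irrational x) : 0 < Int.fract x :=
  lt_of_le_of_ne (Int.fract_nonneg x) fun h => hx ⟨⌊x⌋, by
    have := Int.fract_add_floor x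
    rw [← h, zero_add] at this
    exact_mod_cast this⟩

theorem irrational_cfMap {x : ℝ} (hx : Irrational x) : Irrational (cfMap x) := by
  rw [cfMap_eq_inv_fract, irrational_inv_iff, Int.fract]
  exact hx.sub_intCast _

theorem one_lt_cfMap {x : ℝ} (hx : Irrational x) : 1 < cfMap x := by
  rw [cfMap_eq_inv_fract]
  exact (one_lt_inv₀ (fract_pos_of_irrational hx)).2 (Int.fract_lt_one x)

theorem irrational_cfMap_iterate {x : ℝ} (hx : Irrational x) (n : ℕ) :
    Irrational (cfMap^[n] x) := by
  induction n with
  | zero => exact hx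
  | succ n ih => rw [Function.iterate_succ_apply']; exact irrational_cfMap ih

theorem one_lt_cfMap_iterate {x : ℝ} (hx : Irrational x) (n : ℕ) :
    1 < cfMap^[n + 1] x := by
  rw [Function.iterate_succ_apply']
  exact one_lt_cfMap (irrational_cfMap_iterate hx n)

/-- `y` and `z` are the conjugate numbers `(P ± s) / Q`, where `s ^ 2 = E` and `Q ∣ E - P ^ 2`. -/
def IsQuadraticPair (E : ℤ) (s y z : ℝ) : Prop :=
  ∃ P Q R : ℤ, Q ≠ 0 ∧ Q * R = E - P ^ 2 ∧ y = (P + s) / Q ∧ z = (P - s) / Q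

theorem IsQuadraticPair.inv_sub {E : ℤ} {s y z : ℝ} (hs : s ^ 2 = E) (hirr : Irrational s)
    (h : IsQuadraticPair E s y z) (a : ℤ) : IsQuadraticPair E s (y - a)⁻¹ (z - a)⁻¹ := by
  obtain ⟨P, Q, R, hQ, hR, rfl, rfl⟩ := h
  have hne : ∀ m : ℤ, s + m ≠ 0 := fun m => (hirr.add_intCast m).ne_zero
  have hQ' : (Q : ℝ) ≠ 0 := by exact_mod_cast hQ
  set P' : ℤ := a * Q - P with hP'
  have h1 : s - P' ≠ 0 := by simpa [sub_eq_add_neg] using hne (-P')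
  have h2 : s + P' ≠ 0 := hne P'
  set Q' : ℤ := R + 2 * a * P - a ^ 2 * Q with hQ'def
  have key : Q * Q' = E - P' ^ 2 := by rw [hQ'def, hP']; linear_combination hR
  have keyR : (Q : ℝ) * Q' = (s - P') * (s + P') := by
    have : (Q : ℝ) * Q' = E - P' ^ 2 := by exact_mod_cast key
    rw [this, ← hs]; ring
  have hQ1 : (Q' : ℝ) ≠ 0 := by
    intro h0
    rw [h0, mul_zero] at keyR
    exact mul_ne_zero h1 h2 keyR.symm
  have hP'R : (P' : ℝ) = a * Q - P := by rw [hP']; push_cast; ring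
  refine ⟨P', Q', Q, by exact_mod_cast hQ1, by rw [← key]; ring, ?_, ?_⟩
  · have : ((P : ℝ) + s) / Q - a = (s - P') / Q := by field_simp; rw [hP'R]; ring
    rw [this, inv_div, div_eq_div_iff h1 hQ1, keyR]; ring
  · have : ((P : ℝ) - s) / Q - a = -(s + P') / Q := by field_simp; rw [hP'R]; ring
    rw [this, inv_div, div_eq_div_iff (neg_ne_zero.2 h2) hQ1, keyR]; ring

/-- `y > 1` is a quadratic irrational attached to `s ^ 2 = E` with negative conjugate. -/
def IsReducedQuadratic (E : ℤ) (s y : ℝ) : Prop :=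
  1 < y ∧ ∃ z < 0, IsQuadraticPair E s y z

theorem isReducedQuadratic_cfMap {E : ℤ} {s y : ℝ} (hs : s ^ 2 = E) (hirr : Irrational s)
    (hy : Irrational y) (h : IsReducedQuadratic E s y) : IsReducedQuadratic E s (cfMap y) := by
  obtain ⟨h1, z, hz, hyz⟩ := h
  refine ⟨one_lt_cfMap hy, (z - ⌊y⌋)⁻¹, ?_, ?_⟩
  · have : (0 : ℝ) ≤ ⌊y⌋ := by exact_mod_cast Int.floor_nonneg.2 (by linarith)
    exact inv_lt_zero.2 (by linarith)
  · rw [cfMap_eq_inv_fract]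
    exact hyz.inv_sub hs hirr _

theorem IsReducedQuadratic.exists_bounds {E : ℤ} {s y : ℝ} (hs0 : 0 < s)
    (h : IsReducedQuadratic E s y) :
    ∃ P Q : ℤ, 0 < Q ∧ (Q : ℝ) < 2 * s ∧ |(P : ℝ)| < s ∧ y = (P + s) / Q := by
  obtain ⟨h1, z, hz, P, Q, R, hQ, hR, hy, rfl⟩ := h
  have hQ0 : (0 : ℝ) < Q := by
    have h2 : 0 < (2 * s) / Q := by
      have : (2 * s) / Q = y - (P - s) / Q := by rw [hy]; ring
      rw [this]; linarith
    exact (div_pos_iff_of_pos_left (by linarith)).1 h2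
  rw [div_neg_iff] at hz
  have hP : (P : ℝ) < s := by rcases hz with hz | hz <;> linarith
  rw [hy, lt_div_iff₀ hQ0] at h1
  exact ⟨P, Q, by exact_mod_cast hQ0, by linarith, abs_lt.2 ⟨by linarith, hP⟩, hy⟩

theorem IsReducedQuadratic.lt {E : ℤ} {s y : ℝ} (hs0 : 0 < s)
    (h : IsReducedQuadratic E s y) : y < 2 * s := by
  obtain ⟨P, Q, hQ, -, hP, rfl⟩ := h.exists_bounds hs0
  have hQ1 : (1 : ℝ) ≤ Q := by exact_mod_cast hQ
  rw [div_lt_iff₀ (by linarith)]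
  have := (abs_lt.1 hP).2
  nlinarith

theorem finite_setOf_isReducedQuadratic (E : ℤ) {s : ℝ} (hs0 : 0 < s) :
    {y | IsReducedQuadratic E s y}.Finite := by
  let I : Set ℤ := Set.Icc (-⌈2 * s⌉) ⌈2 * s⌉
  have hI : (I ×ˢ I).Finite := (Set.finite_Icc _ _).prod (Set.finite_Icc _ _)
  refine (hI.image fun PQ : ℤ × ℤ => ((PQ.1 : ℝ) + s) / PQ.2).subset ?_
  rintro y hy
  obtain ⟨P, Q, hQ, hQs, hP, rfl⟩ := hy.exists_bounds hs0
  rw [abs_lt] at hP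
  have hc := Int.le_ceil (2 * s)
  have hc0 : (0 : ℤ) ≤ ⌈2 * s⌉ := Int.ceil_nonneg (by linarith)
  refine ⟨(P, Q), ⟨⟨?_, ?_⟩, ?_, ?_⟩, rfl⟩
  · have : -(⌈2 * s⌉ : ℝ) ≤ P := by linarith
    exact_mod_cast this
  · have : (P : ℝ) ≤ ⌈2 * s⌉ := by linarith
    exact_mod_cast this
  · show -⌈2 * s⌉ ≤ Q
    omega
  · have : (Q : ℝ) ≤ ⌈2 * s⌉ := by linarith
    exact_mod_cast this

theorem exists_cfa_period {x : ℝ} {n₀ : ℕ} {S : Set ℝ} (hS : S.Finite)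
    (hx : ∀ n ≥ n₀, cfMap^[n] x ∈ S) :
    ∃ p : ℕ, 0 < p ∧ ∃ N : ℕ, ∀ n ≥ N, cfa x (n + p) = cfa x n := by
  obtain ⟨i, j, hij, h⟩ : ∃ i j : ℕ, i < j ∧ cfMap^[n₀ + i] x = cfMap^[n₀ + j] x := by
    have : ¬ Function.Injective fun i : ℕ => cfMap^[n₀ + i] x := fun hinj =>
      Set.infinite_range_of_injective hinj
        (hS.subset (by rintro _ ⟨i, rfl⟩; exact hx _ (by omega)))
    simp only [Function.Injective, not_forall] at this
    obtain ⟨i, j, h, hne⟩ := this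
    rcases lt_or_gt_of_ne hne with hlt | hlt
    · exact ⟨i, j, hlt, h⟩
    · exact ⟨j, i, hlt, h.symm⟩
  refine ⟨j - i, by omega, n₀ + i, fun n hn => ?_⟩
  obtain ⟨m, rfl⟩ := Nat.exists_eq_add_of_le hn
  have e1 : n₀ + i + m + (j - i) = m + (n₀ + j) := by omega
  unfold cfa
  rw [e1, Function.iterate_add_apply, ← h, ← Function.iterate_add_apply, add_comm m]

theorem cfMap_iterate_eq_of_cfa_eq {x : ℝ} (hx : Irrational x) {n₀ L : ℕ} {S : Set ℝ}
    (hS : S.Finite) (hxS : ∀ n ≥ n₀, cfMap^[n] x ∈ S)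
    (hL : ∀ n ≥ n₀, cfa x (n + L) = cfa x n) :
    cfMap^[n₀ + L] x = cfMap^[n₀] x := by
  by_contra hne
  set d : ℕ → ℝ := fun n => |cfMap^[n₀ + n + L] x - cfMap^[n₀ + n] x| with hd
  have step : ∀ n, 0 < d n → d n < d (n + 1) := by
    intro n hn
    have h1 := one_lt_cfMap_iterate hx (n₀ + n + L)
    have h2 := one_lt_cfMap_iterate hx (n₀ + n)
    have hdn : d (n + 1) = |cfMap^[n₀ + n + L + 1] x - cfMap^[n₀ + n + 1] x| := by
      simp only [hd]
      congr 3
      ring_nf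
    have ha := hL (n₀ + n) (by omega)
    unfold cfa at ha
    set u := cfMap^[n₀ + n + L] x with hu
    set v := cfMap^[n₀ + n] x with hv
    rw [hdn]
    rw [Function.iterate_succ_apply', ← hu] at h1 ⊢
    rw [Function.iterate_succ_apply', ← hv] at h2 ⊢
    have hdn' : d n = |u - v| := rfl
    have hu' : u = ⌊v⌋ + (cfMap u)⁻¹ := by
      rw [cfMap_eq_inv_fract, inv_inv, ← ha]; exact (Int.floor_add_fract u).symm
    have hv' : v = ⌊v⌋ + (cfMap v)⁻¹ := by
      rw [cfMap_eq_inv_fract, inv_inv]; exact (Int.floor_add_fract v).symm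
    have e : (cfMap u - cfMap v) = -(u - v) * (cfMap u * cfMap v) := by
      rw [show u - v = (cfMap u)⁻¹ - (cfMap v)⁻¹ by linarith]
      have := (zero_lt_one.trans h1).ne'
      have := (zero_lt_one.trans h2).ne'
      field_simp
      ring
    rw [e, abs_mul, abs_neg, ← hdn', abs_of_pos (by positivity : 0 < cfMap u * cfMap v)]
    exact lt_mul_of_one_lt_right hn (one_lt_mul_of_lt_of_le h1 h2.le)
  have h0 : 0 < d 0 := abs_pos.2 (sub_ne_zero.2 hne)
  have hpos : ∀ n, 0 < d n := fun n => by
    induction n with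
    | zero => exact h0
    | succ n ih => exact ih.trans (step n ih)
  have hmono : StrictMono d := strictMono_nat_of_lt_succ fun n => step n (hpos n)
  refine Set.infinite_range_of_injective hmono.injective
    (((hS.prod hS).image fun uv : ℝ × ℝ => |uv.1 - uv.2|).subset ?_)
  rintro _ ⟨n, rfl⟩
  exact ⟨(_, _), ⟨hxS _ (by omega), hxS _ (by omega)⟩, rfl⟩

theorem exists_unimodular_cfMap_iterate {x : ℝ} (hx : Irrational x) (n : ℕ) :
    ∃ p q r s : ℤ, (p * s - q * r) ^ 2 = 1 ∧
      p * cfMap^[n] x + q = (∏ i ∈ Finset.range n, cfMap^[i + 1] x) * x ∧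
      r * cfMap^[n] x + s = ∏ i ∈ Finset.range n, cfMap^[i + 1] x := by
  induction n with
  | zero => exact ⟨1, 0, 0, 1, by norm_num, by simp, by simp⟩
  | succ n ih =>
    obtain ⟨p, q, r, s, hdet, h1, h2⟩ := ih
    have hy := one_lt_cfMap_iterate hx n
    rw [Finset.prod_range_succ]
    set ρ := ∏ i ∈ Finset.range n, cfMap^[i + 1] x
    rw [Function.iterate_succ_apply'] at hy ⊢
    set y := cfMap^[n] x
    have e : y = ⌊y⌋ + (cfMap y)⁻¹ := by
      rw [cfMap_eq_inv_fract, inv_inv]; exact (Int.floor_add_fract y).symm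
    have e' : y * cfMap y = ⌊y⌋ * cfMap y + 1 := by
      have := (zero_lt_one.trans hy).ne'
      nth_rewrite 1 [e]
      field_simp
    refine ⟨p * ⌊y⌋ + q, p, r * ⌊y⌋ + s, r, by linear_combination hdet, ?_, ?_⟩
    · push_cast
      linear_combination cfMap y * h1 - p * e'
    · push_cast
      linear_combination cfMap y * h2 - r * e'

theorem exists_unit_of_cfMap_iterate_eq {x : ℝ} (hx : Irrational x) {n L : ℕ}
    (h : cfMap^[n + L] x = cfMap^[n] x) :
    ∃ A B C F : ℤ, (A * F - B * C) ^ 2 = 1 ∧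
      A * x + B = (∏ i ∈ Finset.range L, cfMap^[n + i + 1] x) * x ∧
      C * x + F = ∏ i ∈ Finset.range L, cfMap^[n + i + 1] x := by
  obtain ⟨p, q, r, s, hdet, h1, h2⟩ := exists_unimodular_cfMap_iterate hx n
  obtain ⟨p', q', r', s', hdet', h1', h2'⟩ := exists_unimodular_cfMap_iterate hx (n + L)
  rw [Finset.prod_range_add, h] at h1' h2'
  have hρ : 0 < ∏ i ∈ Finset.range n, cfMap^[i + 1] x :=
    Finset.prod_pos fun i _ => zero_lt_one.trans (one_lt_cfMap_iterate hx i)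
  set ρ₁ := ∏ i ∈ Finset.range n, cfMap^[i + 1] x
  set ρ := ∏ i ∈ Finset.range L, cfMap^[n + i + 1] x
  set y := cfMap^[n] x
  set δ : ℤ := p * s - q * r with hδ
  have hδR : (δ : ℝ) = p * s - q * r := by rw [hδ]; push_cast; ring
  have hδ1 : (δ : ℝ) ^ 2 = 1 := by exact_mod_cast hdet
  have ey : y = δ * ρ₁ * (s * x - q) := by
    have : δ * y = ρ₁ * (s * x - q) := by rw [hδR]; linear_combination s * h1 - q * h2
    linear_combination δ * this - y * hδ1
  have e1 : (1 : ℝ) = δ * ρ₁ * (p - r * x) := by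
    have : (δ : ℝ) = ρ₁ * (p - r * x) := by rw [hδR]; linear_combination p * h2 - r * h1
    linear_combination δ * this - hδ1
  refine ⟨δ * (p' * s - q' * r), δ * (q' * p - p' * q), δ * (r' * s - s' * r),
    δ * (s' * p - r' * q), ?_, ?_, ?_⟩
  · have : (δ * (p' * s - q' * r) * (δ * (s' * p - r' * q)) -
        δ * (q' * p - p' * q) * (δ * (r' * s - s' * r))) = δ ^ 2 * δ * (p' * s' - q' * r') := by
      rw [hδ]; ring
    rw [this, mul_pow, hdet', mul_pow, hdet]; norm_num
  · apply mul_left_cancel₀ hρ.ne'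
    push_cast
    linear_combination h1' - p' * ey - q' * e1
  · apply mul_left_cancel₀ hρ.ne'
    push_cast
    linear_combination h2' - r' * ey - s' * e1

namespace Pell.Solution₁

variable {d : ℤ}

theorem pow_expansion (u : Solution₁ d) (t : ℕ) : (u ^ t).x ≡ u.x ^ t [ZMOD u.y ^ 2] ∧
    ∃ c, (u ^ t).y = t * u.x ^ (t - 1) * u.y + c * u.y ^ 3 := by
  induction t with
  | zero => exact ⟨by simp [Int.ModEq.refl], 0, by simp⟩
  | succ t ih =>
    obtain ⟨hx, c, hc⟩ := ih
    obtain ⟨b, hb⟩ := hx.symm.dvd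
    have hb' : (u ^ t).x = u.x ^ t + u.y ^ 2 * b := by linarith
    refine ⟨?_, ?_⟩
    · rw [pow_succ u, x_mul, hb', hc]
      refine (Int.modEq_iff_dvd.2 ⟨b * u.x + d * (t * u.x ^ (t - 1) + c * u.y ^ 2), ?_⟩).symm
      ring
    · refine ⟨b + c * u.x, ?_⟩
      rw [pow_succ u, y_mul, hb', hc]
      rcases t with - | t
      · simp; ring
      · simp only [Nat.add_sub_cancel]; push_cast; ring

theorem not_dvd_x_of_dvd_y {p : ℤ} (hp : Prime p) {u : Solution₁ d} (h : p ∣ u.y) :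
    ¬ p ∣ u.x := fun hx => hp.not_dvd_one <| by
  rw [← u.prop, sq, sq]
  exact dvd_sub (hx.mul_right _) ((h.mul_right _).mul_left _)

theorem dvd_of_pow_dvd_y_pow {p : ℕ} (hp : p.Prime) (j : ℕ) :
    ∀ {v : ℕ} {u : Solution₁ d} {t : ℕ}, 1 ≤ v → (p : ℤ) ^ v ∣ u.y → ¬ (p : ℤ) ^ (v + 1) ∣ u.y →
      (p : ℤ) ^ (v + j) ∣ (u ^ t).y → p ^ j ∣ t := by
  have hp' : Prime (p : ℤ) := Nat.prime_iff_prime_int.1 hp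
  induction j with
  | zero => intros; simp
  | succ j ih =>
    intro v u t hv hdvd hndvd h
    have hpx : ¬ (p : ℤ) ∣ u.x :=
      not_dvd_x_of_dvd_y hp' ((dvd_pow_self _ (by omega)).trans hdvd)
    obtain ⟨e, he⟩ := hdvd
    have hpe : ¬ (p : ℤ) ∣ e := fun hpe => hndvd <| by
      rw [he, pow_succ]; exact mul_dvd_mul_left _ hpe
    have hp0 : (p : ℤ) ^ v ≠ 0 := pow_ne_zero _ hp'.ne_zero
    have hcube : ∀ c, (p : ℤ) ^ (v + 2) ∣ c * u.y ^ 3 := fun c => by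
      rw [he, mul_pow, ← pow_mul]
      exact ((pow_dvd_pow _ (by omega)).mul_right _).mul_left _
    have hpt : p ∣ t := by
      obtain ⟨c, hc⟩ := (pow_expansion u t).2
      have h1 : (p : ℤ) ^ (v + 1) ∣ t * u.x ^ (t - 1) * u.y := by
        rw [eq_sub_of_add_eq hc.symm]
        exact dvd_sub ((pow_dvd_pow _ (by omega)).trans h)
          ((pow_dvd_pow _ (by omega)).trans (hcube c))
      rw [he, pow_succ, mul_left_comm] at h1
      have h2 := (mul_dvd_mul_iff_left hp0).1 h1
      rcases hp'.dvd_or_dvd h2 with h3 | h3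
      · rcases hp'.dvd_or_dvd h3 with h4 | h4
        · exact_mod_cast h4
        · exact absurd (hp'.dvd_of_dvd_pow h4) hpx
      · exact absurd h3 hpe
    obtain ⟨t, rfl⟩ := hpt
    rw [pow_succ']
    refine mul_dvd_mul_left _ ?_
    obtain ⟨c, hc⟩ := (pow_expansion u p).2
    refine ih (v := v + 1) (u := u ^ p) (by omega) ?_ ?_ ?_
    · rw [hc, he]
      refine dvd_add ⟨u.x ^ (p - 1) * e, by ring⟩ ?_
      rw [← he]
      exact (pow_dvd_pow _ (by omega)).trans (hcube c)
    · intro h3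
      rw [hc] at h3
      have h4 := (dvd_add_left (hcube c)).1 h3
      rw [he, show (p : ℤ) * u.x ^ (p - 1) * (p ^ v * e) = p ^ (v + 1) * (u.x ^ (p - 1) * e) by
        ring, show v + 1 + 1 = (v + 1) + 1 from rfl, pow_succ _ (v + 1)] at h4
      rcases hp'.dvd_or_dvd ((mul_dvd_mul_iff_left (pow_ne_zero _ hp'.ne_zero)).1 h4) with h5 | h5
      · exact hpx (hp'.dvd_of_dvd_pow h5)
      · exact hpe h5
    · rw [← pow_mul, show v + 1 + j = v + (j + 1) by ring]
      exact h

theorem dvd_y_pow (u : Solution₁ d) (t : ℕ) : u.y ∣ (u ^ t).y := by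
  induction t with
  | zero => simp
  | succ t ih =>
    rw [pow_succ, y_mul]
    exact dvd_add (dvd_mul_left _ _) (ih.mul_right _)

theorem two_pow_le_x_pow {a : Solution₁ d} (hax : 1 < a.x) (hay : 0 ≤ a.y) (m : ℕ) :
    2 ^ m ≤ (a ^ m).x ∧ 0 ≤ (a ^ m).y := by
  have hd := d_pos_of_one_lt_x hax
  induction m with
  | zero => simp
  | succ m ih =>
    obtain ⟨ih1, ih2⟩ := ih
    have h0 : (0 : ℤ) < 2 ^ m := by positivity
    rw [pow_succ a, x_mul, y_mul, pow_succ]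
    have : 0 ≤ d * ((a ^ m).y * a.y) := mul_nonneg hd.le (mul_nonneg ih2 hay)
    have h2 : 0 ≤ (a ^ m).x := h0.le.trans ih1
    exact ⟨by nlinarith [mul_le_mul ih1 hax (by norm_num) h2],
      add_nonneg (mul_nonneg h2 hay) (mul_nonneg ih2 (by linarith))⟩

end Pell.Solution₁

theorem Pell.IsFundamental.exists_pow_eq_abs {d : ℤ} {a : Pell.Solution₁ d}
    (ha : Pell.IsFundamental a) (w : Pell.Solution₁ d) :
    ∃ m : ℕ, (a ^ m).x = |w.x| ∧ (a ^ m).y = |w.y| := by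
  have key : ∀ n : ℤ, (a ^ n.natAbs).x = |(a ^ n).x| ∧ (a ^ n.natAbs).y = |(a ^ n).y| := by
    intro n
    obtain ⟨hx, hy⟩ := Solution₁.two_pow_le_x_pow ha.1 ha.2.1.le n.natAbs
    have hx' : 0 ≤ (a ^ n.natAbs).x := le_trans (by positivity) hx
    rcases Int.natAbs_eq n with h | h
    · rw [h, zpow_natCast, Int.natAbs_natCast, abs_of_nonneg hx', abs_of_nonneg hy]
      exact ⟨rfl, rfl⟩
    · rw [h, zpow_neg, zpow_natCast, Int.natAbs_neg, Int.natAbs_natCast, Solution₁.x_inv,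
        Solution₁.y_inv, abs_neg, abs_of_nonneg hx', abs_of_nonneg hy]
      exact ⟨rfl, rfl⟩
  obtain ⟨n, rfl | rfl⟩ := ha.eq_zpow_or_neg_zpow w
  · exact ⟨_, key n⟩
  · refine ⟨n.natAbs, ?_⟩
    rw [Solution₁.x_neg, Solution₁.y_neg, abs_neg, abs_neg]
    exact key n

/-- Solutions of Pell's equation whose second coordinate is divisible by `p ^ k` are large. -/
theorem Pell.exists_two_pow_le_of_pow_dvd_y {d : ℤ} (h₀ : 0 < d) (hd : ¬ IsSquare d) {p : ℕ}
    (hp : p.Prime) : ∃ v : ℕ, ∀ (k : ℕ) (w : Pell.Solution₁ d), w.y ≠ 0 → (p : ℤ) ^ k ∣ w.y →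
      2 ^ p ^ k ≤ |w.x| ^ p ^ v := by
  have hp' : Prime (p : ℤ) := Nat.prime_iff_prime_int.1 hp
  obtain ⟨a, ha⟩ := Pell.IsFundamental.exists_of_not_isSquare h₀ hd
  obtain ⟨u, hpu, hu0⟩ : ∃ u : Pell.Solution₁ d, (p : ℤ) ∣ u.y ∧ u.y ≠ 0 := by
    have hsq : ¬ IsSquare (d * p ^ 2) := by
      rintro ⟨r, hr⟩
      have hpr : (p : ℤ) ∣ r := by
        rw [← Int.pow_dvd_pow_iff two_ne_zero, sq r, ← hr]
        exact dvd_mul_left _ _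
      obtain ⟨c, rfl⟩ := hpr
      refine hd ⟨c, mul_right_cancel₀ (pow_ne_zero 2 hp'.ne_zero) ?_⟩
      rw [hr]; ring
    obtain ⟨x, y, hxy, hy⟩ := Pell.exists_of_not_isSquare
      (mul_pos h₀ (pow_pos (by exact_mod_cast hp.pos) 2)) hsq
    refine ⟨Pell.Solution₁.mk x (p * y) (by linear_combination hxy), ?_, ?_⟩
    · simp
    · simpa using ⟨hp.ne_zero, hy⟩
  obtain ⟨j, -, hj⟩ := ha.exists_pow_eq_abs u
  have huj0 : (a ^ j).y ≠ 0 := by rw [hj]; exact abs_ne_zero.2 hu0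
  have hpuj : (p : ℤ) ∣ (a ^ j).y := by rw [hj]; exact (dvd_abs _ _).2 hpu
  have hfin : FiniteMultiplicity (p : ℤ) (a ^ j).y :=
    Int.finiteMultiplicity_iff.2 ⟨by simpa using hp.ne_one, huj0⟩
  set v := multiplicity (p : ℤ) (a ^ j).y with hv
  refine ⟨v, fun k w hw hk => ?_⟩
  obtain ⟨m, hmx, hmy⟩ := ha.exists_pow_eq_abs w
  have hm0 : 0 < m := Nat.pos_of_ne_zero fun hm => by
    rw [hm, pow_zero, Pell.Solution₁.y_one] at hmy
    exact hw (abs_eq_zero.1 hmy.symm)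
  have hkm : p ^ k ≤ m * p ^ v := by
    rcases le_total k v with hkv | hkv
    · exact (Nat.pow_le_pow_right hp.pos hkv).trans (Nat.le_mul_of_pos_left _ hm0)
    · have hdvd : (p : ℤ) ^ (v + (k - v)) ∣ ((a ^ j) ^ m).y := by
        rw [Nat.add_sub_cancel' hkv, ← pow_mul, mul_comm, pow_mul]
        refine dvd_trans ?_ (Pell.Solution₁.dvd_y_pow _ _)
        rw [hmy]
        exact (dvd_abs _ _).2 hk
      have h1 : p ^ (k - v) ∣ m := Pell.Solution₁.dvd_of_pow_dvd_y_pow hp (k - v)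
        (hfin.le_multiplicity_of_pow_dvd (by simpa using hpuj)) (pow_multiplicity_dvd _ _)
        (hfin.not_pow_dvd_of_multiplicity_lt (by omega)) hdvd
      calc p ^ k = p ^ (k - v) * p ^ v := by rw [← pow_add, Nat.sub_add_cancel hkv]
        _ ≤ m * p ^ v := Nat.mul_le_mul_right _ (Nat.le_of_dvd hm0 h1)
  calc (2 : ℤ) ^ p ^ k ≤ 2 ^ (m * p ^ v) := pow_le_pow_right₀ (by norm_num) hkm
    _ = (2 ^ m) ^ p ^ v := pow_mul _ _ _
    _ ≤ |w.x| ^ p ^ v := by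
      rw [← hmx]
      exact pow_le_pow_left₀ (by positivity)
        (Pell.Solution₁.two_pow_le_x_pow ha.1 ha.2.1.le m).1 _

theorem Polynomial.exists_int_map_eq_smul (F : ℚ[X]) :
    ∃ c : ℤ, c ≠ 0 ∧ ∃ G : ℤ[X], G.map (Int.castRingHom ℚ) = C (c : ℚ) * F := by
  obtain ⟨b, hb0, hb⟩ := IsLocalization.integerNormalization_spec (nonZeroDivisors ℤ) F
  refine ⟨b, nonZeroDivisors.ne_zero hb0,
    IsLocalization.integerNormalization (nonZeroDivisors ℤ) F, ?_⟩
  rw [← algebraMap_int_eq, hb, ← Polynomial.smul_eq_C_mul]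
  ext i
  simp

theorem Polynomial.exists_int_eval_ne_zero {S : Type*} [CommRing S] [IsDomain S] [CharZero S]
    {Q : S[X]} (hQ : Q ≠ 0) {a b : S} (hb : b ≠ 0) : ∃ y : ℤ, Q.eval (a + b * y) ≠ 0 := by
  by_contra! h
  refine hQ (Polynomial.eq_zero_of_infinite_isRoot Q ?_)
  refine (Set.infinite_range_of_injective (f := fun y : ℤ => a + b * y) ?_).mono ?_
  · intro y z hyz
    exact Int.cast_injective (mul_left_cancel₀ hb (add_left_cancel hyz))
  · rintro _ ⟨y, rfl⟩
    exact h y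

/-- Schur: infinitely many primes divide the values of a nonconstant integer polynomial. -/
theorem Polynomial.exists_prime_dvd_eval {Q : ℤ[X]} (hQ : 1 ≤ Q.natDegree) {M : ℤ} (hM : M ≠ 0) :
    ∃ p : ℕ, p.Prime ∧ ¬ (p : ℤ) ∣ M ∧ ∃ a : ℤ, (p : ℤ) ∣ Q.eval a := by
  have hne : ∀ c : ℤ, Q - C c ≠ 0 := fun c h => by
    have := natDegree_sub_C (p := Q) (a := c)
    rw [h, natDegree_zero] at this
    omega
  obtain ⟨n₀, hn₀⟩ := exists_int_eval_ne_zero (hne 0) (a := 0) one_ne_zero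
  simp only [map_zero, sub_zero, zero_add, one_mul, Int.cast_id] at hn₀
  set c := Q.eval n₀ with hc
  obtain ⟨y, hy⟩ := exists_int_eval_ne_zero (mul_ne_zero (hne c) (hne (-c))) (a := n₀)
    (mul_ne_zero hn₀ hM)
  simp only [Int.cast_id, eval_mul, eval_sub, eval_C] at hy
  obtain ⟨t, ht⟩ := sub_dvd_eval_sub (n₀ + c * M * y) n₀ Q
  rw [← hc] at ht
  have hval : Q.eval (n₀ + c * M * y) = c * (1 + M * y * t) := by linear_combination ht
  have hunit : (1 + M * y * t).natAbs ≠ 1 := fun h => hy <| by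
    rw [hval]
    rcases Int.natAbs_eq_iff.1 h with h | h <;> rw [h] <;> push_cast <;> ring
  obtain ⟨p, hp, hpd⟩ := Int.exists_prime_and_dvd hunit
  refine ⟨p.natAbs, Int.prime_iff_natAbs_prime.1 hp, fun h => hp.not_dvd_one ?_,
    n₀ + c * M * y, ?_⟩
  · rw [Int.natAbs_dvd] at h
    exact (dvd_add_left ((h.mul_right _).mul_right _)).1 hpd
  · rw [Int.natAbs_dvd, hval]
    exact hpd.mul_left _

theorem Polynomial.exists_pow_dvd_eval {Q : ℤ[X]} {p : ℕ} (hp : p.Prime) {a : ℤ}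
    (ha : (p : ℤ) ∣ Q.eval a)
    (hQ : ∀ n : ℤ, (p : ℤ) ∣ Q.eval n → ¬ (p : ℤ) ∣ Q.derivative.eval n) (k : ℕ) :
    ∃ n : ℤ, (p : ℤ) ^ (k + 1) ∣ Q.eval n := by
  induction k with
  | zero => exact ⟨a, by simpa using ha⟩
  | succ k ih =>
    obtain ⟨n, e, he⟩ := ih
    have hcop : IsCoprime (p : ℤ) (Q.derivative.eval n) :=
      (Nat.prime_iff_prime_int.1 hp).coprime_iff_not_dvd.2
        (hQ n (he ▸ (dvd_pow_self _ (by omega)).mul_right _))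
    obtain ⟨g, h, hgh⟩ := hcop
    obtain ⟨c, hc⟩ := Q.binomExpansion n (p ^ (k + 1) * (-(h * e)))
    refine ⟨n + p ^ (k + 1) * (-(h * e)), ?_⟩
    rw [hc, he]
    refine ⟨g * e + c * p ^ k * (h * e) ^ 2, ?_⟩
    linear_combination -((p : ℤ) ^ (k + 1) * e) * hgh

/-- A rational polynomial of positive degree has a `p`-adic root for some prime `p` prime to its
denominators; in terms of congruences. -/
theorem Polynomial.exists_prime_pow_dvd_eval {P : ℚ[X]} (hP : 1 ≤ P.natDegree) :
    ∃ (N : ℕ) (R : ℤ[X]) (p : ℕ), p.Prime ∧ ¬ p ∣ N ∧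
      R.map (Int.castRingHom ℚ) = C (N : ℚ) * P ∧ ∀ k : ℕ, ∃ n : ℤ, (p : ℤ) ^ k ∣ R.eval n := by
  obtain ⟨Q, hQirr, G, rfl⟩ := WfDvdMonoid.exists_irreducible_factor
    (not_isUnit_of_natDegree_pos P hP) (ne_zero_of_natDegree_gt hP)
  obtain ⟨a, b, hab⟩ := hQirr.separable
  obtain ⟨cQ, hcQ, Qz, hQz⟩ := exists_int_map_eq_smul Q
  obtain ⟨cG, hcG, Gz, hGz⟩ := exists_int_map_eq_smul G
  obtain ⟨ca, hca, az, haz⟩ := exists_int_map_eq_smul a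
  obtain ⟨cb, hcb, bz, hbz⟩ := exists_int_map_eq_smul b
  have hinj : Function.Injective (Int.castRingHom ℚ) := Int.cast_injective
  have hbez : C cb * az * Qz + C ca * bz * derivative Qz = C (ca * cb * cQ) := by
    apply map_injective _ hinj
    simp only [Polynomial.map_add, Polynomial.map_mul, map_C, ← derivative_map, haz, hbz, hQz,
      derivative_C_mul, Int.coe_castRingHom, C_mul]
    linear_combination C (ca : ℚ) * C (cb : ℚ) * C (cQ : ℚ) * hab
  have hdeg : 1 ≤ Qz.natDegree := by
    rw [← natDegree_map_eq_of_injective hinj, hQz, natDegree_C_mul (by exact_mod_cast hcQ)]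
    exact hQirr.natDegree_pos
  obtain ⟨p, hp, hpM, x, hx⟩ := exists_prime_dvd_eval hdeg
    (mul_ne_zero (mul_ne_zero (mul_ne_zero hca hcb) hcQ) hcG)
  refine ⟨(cQ * cG).natAbs ^ 2, C (cQ * cG) * (Qz * Gz), p, hp, fun h => hpM ?_, ?_, fun k => ?_⟩
  · rw [mul_assoc]
    exact (Int.natCast_dvd.2 (hp.dvd_of_dvd_pow h)).mul_left _
  · have e : (((cQ * cG).natAbs ^ 2 : ℕ) : ℚ) = (cQ * cG) ^ 2 := by
      rw [Nat.cast_pow, Nat.cast_natAbs, Int.cast_abs, sq_abs, Int.cast_mul]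
    rw [Polynomial.map_mul, Polynomial.map_mul, hQz, hGz, e, map_C, Int.coe_castRingHom]
    simp only [Int.cast_mul, C_mul, C_pow]
    ring
  · obtain ⟨n, hn⟩ := exists_pow_dvd_eval hp hx (fun n h1 h2 => hpM (by
      have := congrArg (eval n) hbez
      simp only [eval_add, eval_mul, eval_C] at this
      rw [← this]
      exact (dvd_add (h1.mul_left _) (h2.mul_left _)).mul_right _)) k
    exact ⟨n, by
      rw [eval_mul, eval_mul]
      exact (((pow_dvd_pow _ (by omega)).trans hn).mul_right _).mul_left _⟩

theorem Polynomial.exists_abs_eval_le (R : ℤ[X]) :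
    ∃ c d : ℕ, ∀ n : ℕ, 1 ≤ n → |R.eval (n : ℤ)| ≤ c * n ^ d := by
  refine ⟨∑ i ∈ Finset.range (R.natDegree + 1), (R.coeff i).natAbs, R.natDegree, fun n hn => ?_⟩
  rw [eval_eq_sum_range]
  refine (Finset.abs_sum_le_sum_abs _ _).trans ?_
  push_cast
  rw [Finset.sum_mul]
  refine Finset.sum_le_sum fun i hi => ?_
  rw [abs_mul, abs_of_nonneg (by positivity : (0 : ℤ) ≤ (n : ℤ) ^ i)]
  refine mul_le_mul_of_nonneg_left (pow_le_pow_right₀ (by exact_mod_cast hn) ?_) (abs_nonneg _)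
  have := Finset.mem_range.1 hi
  omega

theorem Int.dvd_of_sq_dvd_squarefree_mul_sq {D N g : ℤ} (hD : Squarefree D) (hN : N ≠ 0)
    (h : N ^ 2 ∣ D * g ^ 2) : N ∣ g := by
  obtain ⟨N', g', hcop, hN', hg'⟩ := Int.exists_gcd_one (Int.gcd_pos_of_ne_zero_left g hN)
  set e : ℤ := (Int.gcd N g : ℤ)
  have he : e ≠ 0 := by
    rintro he
    rw [he, mul_zero] at hN'
    exact hN hN'
  have h1 : N' ^ 2 ∣ D := by
    have h2 : N' ^ 2 ∣ D * g' ^ 2 := by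
      refine (mul_dvd_mul_iff_right (pow_ne_zero 2 he)).1 ?_
      rw [← mul_pow, ← hN', mul_assoc, ← mul_pow, ← hg']
      exact h
    exact (Int.isCoprime_iff_gcd_eq_one.2 hcop).pow.dvd_of_dvd_mul_right h2
  have h3 : IsUnit N' := hD N' (by rwa [← sq])
  rw [hN', hg']
  exact mul_dvd_mul_right (h3.dvd) _

theorem isReducedQuadratic_cfMap_iterate {E : ℤ} {s x : ℝ} (hs : s ^ 2 = E) (hirr : Irrational s)
    (hx : Irrational x) (hx1 : 1 ≤ |x|) (h : IsQuadraticPair E s x (-x)) {n : ℕ} (hn : 2 ≤ n) :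
    IsReducedQuadratic E s (cfMap^[n] x) := by
  induction n, hn using Nat.le_induction with
  | succ n _ ih =>
    rw [Function.iterate_succ_apply']
    exact isReducedQuadratic_cfMap hs hirr (irrational_cfMap_iterate hx n) ih
  | base =>
    have h1 : IsQuadraticPair E s (cfMap x) (-x - ⌊x⌋)⁻¹ := by
      rw [cfMap_eq_inv_fract]
      exact h.inv_sub hs hirr _
    have h2 := h1.inv_sub hs hirr ⌊cfMap x⌋
    refine ⟨one_lt_cfMap_iterate hx 1, ((-x - ⌊x⌋)⁻¹ - ⌊cfMap x⌋)⁻¹, ?_, ?_⟩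
    · have hfl : (1 : ℝ) ≤ ⌊cfMap x⌋ := by
        exact_mod_cast Int.le_floor.2 (by simpa using (one_lt_cfMap hx).le)
      refine inv_lt_zero.2 (sub_neg.2 (lt_of_lt_of_le ?_ hfl))
      have hlt := Int.lt_floor_add_one x
      have hle := Int.floor_le x
      rcases le_abs.1 hx1 with hpos | hneg
      · have : (-x - ⌊x⌋)⁻¹ < 0 := inv_lt_zero.2 (by linarith)
        linarith
      · exact inv_lt_one_of_one_lt₀ (by linarith)
    · have e : cfMap^[2] x = (cfMap x - ⌊cfMap x⌋)⁻¹ := by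
        rw [Function.iterate_succ_apply', cfMap_eq_inv_fract]; rfl
      rw [e]
      exact h2

/-- A purely quadratic number `√D · f / N` gives rise to a solution of Pell's equation of size
controlled by the period length of its continued fraction. -/
theorem exists_pell_solution_le_pow_periodLength {D N : ℕ} (hD : Squarefree D)
    (hD1 : ¬ IsSquare D) (hN : N ≠ 0) {f : ℤ} {x : ℝ} (hf : f ≠ 0) (hxf : x = √D * (f / N))
    (hx1 : 1 ≤ |x|) :
    ∃ w : Pell.Solution₁ (D : ℤ), w.y ≠ 0 ∧ f ∣ N * w.y ∧
      |(w.x : ℝ)| ≤ 3 * (2 * (N * |(f : ℝ)| * √D)) ^ (2 * periodLength x) := by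
  have hNR : (0 : ℝ) < N := by exact_mod_cast Nat.pos_of_ne_zero hN
  have hfR : (f : ℝ) ≠ 0 := by exact_mod_cast hf
  have hsqrt : Irrational √(D : ℝ) := irrational_sqrt_natCast_iff.2 hD1
  have hsq : √(D : ℝ) ^ 2 = D := Real.sq_sqrt (Nat.cast_nonneg D)
  have hD0 : 0 < √(D : ℝ) := lt_of_le_of_ne (Real.sqrt_nonneg _) hsqrt.ne_zero.symm
  have hxirr : Irrational x := by
    rw [hxf]
    have := hsqrt.mul_ratCast (q := (f : ℚ) / N) (by positivity)
    simpa using this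
  set s : ℝ := N * |(f : ℝ)| * √D with hs
  have hs0 : 0 < s := by positivity
  have hsirr : Irrational s := by
    have := hsqrt.ratCast_mul (q := (N : ℚ) * |(f : ℚ)|) (by positivity)
    simpa [hs] using this
  have hsE : s ^ 2 = ((D * f ^ 2 * N ^ 2 : ℤ) : ℝ) := by
    rw [hs, mul_pow, mul_pow, sq_abs, hsq]; push_cast; ring
  have hpair : IsQuadraticPair (D * f ^ 2 * N ^ 2) s x (-x) := by
    rcases lt_or_gt_of_ne hfR with hneg | hpos
    · refine ⟨0, -N ^ 2, -(D * f ^ 2), by simpa using hN, by ring, ?_, ?_⟩ <;>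
      · rw [hxf, hs, abs_of_neg hneg]; push_cast; field_simp; ring
    · refine ⟨0, N ^ 2, D * f ^ 2, by simpa using hN, by ring, ?_, ?_⟩ <;>
      · rw [hxf, hs, abs_of_pos hpos]; push_cast; field_simp; ring
  set E : ℤ := D * f ^ 2 * N ^ 2
  have hred : ∀ n ≥ 2, IsReducedQuadratic E s (cfMap^[n] x) := fun n hn =>
    isReducedQuadratic_cfMap_iterate hsE hsirr hxirr hx1 hpair hn
  have hfin := finite_setOf_isReducedQuadratic E hs0
  obtain ⟨hL0, n₁, hL⟩ : 0 < periodLength x ∧ ∃ n₁ : ℕ, ∀ n ≥ n₁,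
      cfa x (n + periodLength x) = cfa x n := by
    rw [periodLength, if_pos hxirr]
    exact Nat.sInf_mem (exists_cfa_period hfin hred)
  set L := periodLength x
  have hper := cfMap_iterate_eq_of_cfa_eq hxirr (n₀ := n₁ + 2) (L := L) hfin
    (fun n hn => hred n (by omega)) (fun n hn => hL n (by omega))
  obtain ⟨A, B, C, F, hdet, h1, h2⟩ := exists_unit_of_cfMap_iterate_eq hxirr hper
  have hρ1 : 1 < ∏ i ∈ Finset.range L, cfMap^[n₁ + 2 + i + 1] x := by
    rw [show (1 : ℝ) = ∏ i ∈ Finset.range L, 1 by simp]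
    exact Finset.prod_lt_prod_of_nonempty (fun _ _ => zero_lt_one)
      (fun i _ => one_lt_cfMap_iterate hxirr _) (by simpa using hL0.ne')
  have hρs : ∏ i ∈ Finset.range L, cfMap^[n₁ + 2 + i + 1] x ≤ (2 * s) ^ L := by
    rw [show (2 * s) ^ L = ∏ i ∈ Finset.range L, (2 * s) by simp]
    exact Finset.prod_le_prod
      (fun i _ => (zero_lt_one.trans (one_lt_cfMap_iterate hxirr _)).le)
      (fun i _ => ((hred _ (by omega)).lt hs0).le)
  set ρ := ∏ i ∈ Finset.range L, cfMap^[n₁ + 2 + i + 1] x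
  have hx2 : x ^ 2 = ((D * f ^ 2 / N ^ 2 : ℚ) : ℝ) := by
    rw [hxf, mul_pow, hsq]; push_cast; ring
  have hquad : C * x ^ 2 + (F - A) * x - B = 0 := by linear_combination x * h2 - h1
  have hFA : F = A := by
    by_contra hne
    have hne' : ((F : ℝ) - A) ≠ 0 := sub_ne_zero.2 (by exact_mod_cast hne)
    refine hxirr ⟨(B - C * (D * f ^ 2 / N ^ 2 : ℚ)) / (F - A), ?_⟩
    rw [Rat.cast_div, Rat.cast_sub, Rat.cast_mul, ← hx2]
    push_cast
    rw [div_eq_iff hne']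
    linear_combination -hquad
  subst hFA
  have hBx : (B : ℝ) = C * x ^ 2 := by linear_combination -hquad
  obtain ⟨b, hb⟩ : (N : ℤ) ∣ C * f := by
    refine Int.dvd_of_sq_dvd_squarefree_mul_sq (Int.squarefree_natCast.2 hD)
      (by exact_mod_cast hN) ⟨B * C, ?_⟩
    have : (D : ℝ) * (C * f) ^ 2 = N ^ 2 * (B * C) := by
      rw [hBx, hxf, mul_pow √(D : ℝ), hsq]; field_simp
    exact_mod_cast this
  have hbR : (C : ℝ) * f = N * b := by exact_mod_cast hb
  have hCx : C * x = b * √D := by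
    rw [hxf, ← mul_assoc, mul_comm (C : ℝ), mul_assoc, ← mul_div_assoc, hbR]
    field_simp
  have hBC : B * C = D * b ^ 2 := by
    have : (B : ℝ) * C = D * b ^ 2 := by
      rw [hBx, ← hsq]
      linear_combination (C * x + b * √D) * hCx
    exact_mod_cast this
  rw [hBC] at hdet
  have hρ : ρ = F + b * √D := by rw [← h2, hCx, add_comm]
  have hnorm : ((F : ℝ) ^ 2 - D * b ^ 2) ^ 2 = 1 := by
    have : ((F ^ 2 - D * b ^ 2 : ℤ) : ℝ) ^ 2 = 1 := by rw [sq F]; exact_mod_cast hdet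
    push_cast at this
    exact this
  have hconj : |F - b * √D| ≤ 1 := by
    have e : ρ * (F - b * √D) = F ^ 2 - D * b ^ 2 := by
      rw [hρ]; linear_combination -(b : ℝ) ^ 2 * hsq
    have h3 : |ρ| * |F - b * √D| = 1 := by
      rw [← abs_mul, e]
      exact (pow_eq_one_iff_of_nonneg (abs_nonneg _) two_ne_zero).1 (by rwa [sq_abs])
    rw [abs_of_pos (by linarith)] at h3
    nlinarith [abs_nonneg (F - b * √D)]
  have hFρ : |(F : ℝ)| ≤ ρ := by
    have := abs_le.1 hconj
    rw [abs_le]; constructor <;> linarith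
  have hb0 : b ≠ 0 := by
    rintro rfl
    simp only [Int.cast_zero, zero_mul, sub_zero, add_zero] at hconj hρ
    have := le_abs_self (F : ℝ)
    linarith
  have hF0 : F ≠ 0 := by
    rintro rfl
    have h4 : (D : ℤ) * b ^ 2 ∣ 1 := ⟨D * b ^ 2, by linear_combination -hdet⟩
    have h5 : (D : ℤ) ∣ 1 := (dvd_mul_right _ _).trans h4
    have : D = 1 := Nat.dvd_one.1 (by exact_mod_cast h5)
    exact hD1 (this ▸ IsSquare.one)
  refine ⟨Pell.Solution₁.mk (F ^ 2 + D * b ^ 2) (2 * F * b) (by linear_combination hdet),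
    ?_, ?_, ?_⟩
  · simp [hF0, hb0]
  · rw [Pell.Solution₁.y_mk]
    exact ⟨2 * F * C, by linear_combination -2 * F * hb⟩
  · rw [Pell.Solution₁.x_mk, mul_comm 2 L, pow_mul]
    have h6 : (D : ℝ) * b ^ 2 ≤ F ^ 2 + 1 := by nlinarith
    have h7 : (F : ℝ) ^ 2 ≤ ρ ^ 2 := sq_le_sq.2 (by rwa [abs_of_pos (by linarith : 0 < ρ)])
    have h8 : ρ ^ 2 ≤ ((2 * s) ^ L) ^ 2 := pow_le_pow_left₀ (by linarith) hρs 2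
    push_cast
    rw [abs_of_nonneg (by positivity)]
    nlinarith

theorem exists_mul_pow_lt_two_pow (c : ℝ) (e : ℕ) :
    ∃ q₀ : ℕ, ∀ q ≥ q₀, c * (q : ℝ) ^ e < 2 ^ q := by
  have h := (tendsto_pow_const_div_const_pow_of_one_lt e (one_lt_two (α := ℝ))).const_mul c
  rw [mul_zero] at h
  obtain ⟨q₀, hq₀⟩ := eventually_atTop.1 (h.eventually_lt_const zero_lt_one)
  refine ⟨q₀, fun q hq => ?_⟩
  have := hq₀ q hq
  rwa [← mul_div_assoc, div_lt_one (by positivity)] at this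

theorem periodLength_unbounded_of_squarefree {D : ℕ} (hD : Squarefree D) (hD1 : ¬ IsSquare D)
    {P : ℚ[X]} (hP : 1 ≤ P.natDegree) (B : ℕ) :
    ∃ n : ℕ, B < periodLength (√D * ((P.eval (n : ℚ) : ℚ) : ℝ)) := by
  by_contra! hB
  obtain ⟨N, R, p, hp, hpN, hR, hroot⟩ := exists_prime_pow_dvd_eval hP
  have hN : N ≠ 0 := fun h => hpN (h ▸ dvd_zero p)
  have hNR : (0 : ℝ) < N := by exact_mod_cast Nat.pos_of_ne_zero hN
  have hp' : Prime (p : ℤ) := Nat.prime_iff_prime_int.1 hp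
  have hD0 : 0 < D := Nat.pos_of_ne_zero hD.ne_zero
  have hDR : 1 ≤ √(D : ℝ) := Real.one_le_sqrt.2 (by exact_mod_cast hD0)
  obtain ⟨v, hv⟩ := Pell.exists_two_pow_le_of_pow_dvd_y (d := D) (by exact_mod_cast hD0)
    (by rwa [Int.isSquare_natCast_iff]) hp
  obtain ⟨c, d, hcd⟩ := R.exists_abs_eval_le
  have hR0 : R ≠ 0 := by
    rintro rfl
    rw [Polynomial.map_zero, zero_eq_mul, C_eq_zero, Nat.cast_eq_zero] at hR
    rcases hR with h | rfl
    · exact hN h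
    · simp at hP
  obtain ⟨n₀, hn₀⟩ : ∃ n₀ : ℕ, ∀ n : ℕ, R.eval (n : ℤ) = 0 → n ≤ n₀ := by
    have : {n : ℕ | R.eval (n : ℤ) = 0}.Finite :=
      (R.finite_setOfPred_isRoot hR0).preimage Nat.cast_injective.injOn
    obtain ⟨n₀, h⟩ := this.bddAbove
    exact ⟨n₀, fun n hn => h hn⟩
  set K : ℝ := 2 * (N * c * √D) * 2 ^ d with hK
  obtain ⟨q₀, hq₀⟩ := exists_mul_pow_lt_two_pow ((3 * K ^ (2 * B)) ^ p ^ v) (d * (2 * B) * p ^ v)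
  set k := q₀ + n₀ + N with hk
  set q := p ^ k with hq
  have hkq : k < q := Nat.lt_pow_self hp.one_lt
  obtain ⟨m, hm⟩ := hroot k
  have hq0 : (0 : ℤ) < (q : ℤ) := by exact_mod_cast (Nat.zero_le _).trans_lt hkq
  have hmod0 := Int.emod_nonneg m hq0.ne'
  have hmod1 := Int.emod_lt_of_pos m hq0
  obtain ⟨n, hn⟩ := Int.eq_ofNat_of_zero_le (add_nonneg hmod0 hq0.le)
  have hnq : q ≤ n := by omega
  have hn2 : n ≤ 2 * q := by omega
  set f := R.eval (n : ℤ) with hf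
  have hf0 : f ≠ 0 := fun h => by have := hn₀ n h; omega
  have hqf : (q : ℤ) ∣ f := by
    have h1 : (q : ℤ) ∣ n - m := by
      rw [← hn]
      exact ⟨1 - m / q, by linear_combination Int.emod_add_mul_ediv m q⟩
    have h2 := h1.trans (sub_dvd_eval_sub (n : ℤ) m R)
    refine (dvd_sub_left ?_).1 h2
    rw [hq]
    push_cast
    exact hm
  have hqf' : (q : ℝ) ≤ |(f : ℝ)| := by
    have := Int.le_of_dvd (abs_pos.2 hf0) ((dvd_abs _ _).2 hqf)
    exact_mod_cast this
  have hNq : (N : ℝ) ≤ q := by exact_mod_cast (by omega : N ≤ q)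
  have hx : √D * ((P.eval (n : ℚ) : ℚ) : ℝ) = √D * (f / N) := by
    have h1 : (f : ℚ) = N * P.eval (n : ℚ) := by
      have h2 := congrArg (eval ((Int.castRingHom ℚ) n)) hR
      rw [eval_map_apply] at h2
      simpa using h2
    have h2 : (f : ℝ) = N * ((P.eval (n : ℚ) : ℚ) : ℝ) := by
      exact_mod_cast congrArg (Rat.cast (K := ℝ)) h1
    rw [h2, mul_div_cancel_left₀ _ hNR.ne']
  have hBn := hB n
  rw [hx] at hBn
  have hx1 : 1 ≤ |√D * ((f : ℝ) / N)| := by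
    rw [abs_mul, abs_div, abs_of_pos hNR, abs_of_nonneg (by linarith)]
    have : 1 ≤ |(f : ℝ)| / N := (one_le_div hNR).2 (by linarith)
    nlinarith
  obtain ⟨w, hw0, hfw, hwx⟩ := exists_pell_solution_le_pow_periodLength hD hD1 hN hf0 rfl hx1
  have hqw : (p : ℤ) ^ k ∣ w.y := by
    have hcop : IsCoprime ((p : ℤ) ^ k) N :=
      (hp'.coprime_iff_not_dvd.2 (by exact_mod_cast hpN)).pow_left
    refine hcop.dvd_of_dvd_mul_left (dvd_trans ?_ hfw)
    exact_mod_cast hqf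
  have hlow : (2 : ℝ) ^ q ≤ |(w.x : ℝ)| ^ p ^ v := by exact_mod_cast hv k w hw0 hqw
  have hN1 : (1 : ℝ) ≤ N := by exact_mod_cast Nat.one_le_iff_ne_zero.2 hN
  have hs1 : 1 ≤ 2 * (N * |(f : ℝ)| * √D) := by
    have h1 : 1 ≤ N * |(f : ℝ)| := by nlinarith
    nlinarith
  have hsK : 2 * (N * |(f : ℝ)| * √D) ≤ K * q ^ d := by
    have h1 : |(f : ℝ)| ≤ c * (n : ℝ) ^ d := by exact_mod_cast hcd n (by omega)
    have h2 : (n : ℝ) ^ d ≤ (2 * q) ^ d :=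
      pow_le_pow_left₀ (by positivity) (by exact_mod_cast hn2) d
    calc 2 * (N * |(f : ℝ)| * √D) ≤ 2 * (N * (c * (2 * q) ^ d) * √D) := by
          gcongr
          exact h1.trans (by gcongr)
      _ = K * q ^ d := by rw [hK, mul_pow]; ring
  refine absurd (hq₀ q (by omega)) (not_lt.2 ?_)
  calc (2 : ℝ) ^ q ≤ |(w.x : ℝ)| ^ p ^ v := hlow
    _ ≤ (3 * (K * q ^ d) ^ (2 * B)) ^ p ^ v := by
      refine pow_le_pow_left₀ (abs_nonneg _) (hwx.trans ?_) _
      refine mul_le_mul_of_nonneg_left ?_ (by norm_num)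
      exact (pow_le_pow_right₀ hs1 (by omega)).trans
        (pow_le_pow_left₀ (by linarith) hsK _)
    _ = (3 * K ^ (2 * B)) ^ p ^ v * (q : ℝ) ^ (d * (2 * B) * p ^ v) := by
      rw [mul_pow K, ← pow_mul, ← mul_assoc, mul_pow (3 * K ^ (2 * B)), ← pow_mul]

/-- for `D` a positive integer which is not a perfect square and `P ∈ ℚ[X]`
of degree at least one, the period lengths of the continued fractions of `√D · P(n)` are
unbounded. -/
theorem stmt_19 (D : ℕ) (hD : 0 < D) (hsq : ¬ IsSquare D)
    (P : Polynomial ℚ) (hdeg : 1 ≤ P.natDegree) :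
    ∀ B : ℕ, ∃ n : ℕ, B < periodLength (Real.sqrt D * ((P.eval (n : ℚ) : ℚ) : ℝ)) := by
  intro B
  obtain ⟨a, b, hab, ha⟩ := Nat.sq_mul_squarefree D
  have hb : b ≠ 0 := by
    rintro rfl
    simp at hab
    omega
  have ha1 : ¬ IsSquare a := by
    rintro ⟨r, rfl⟩
    exact hsq ⟨b * r, by rw [← hab]; ring⟩
  obtain ⟨n, hn⟩ := periodLength_unbounded_of_squarefree ha ha1 (P := C (b : ℚ) * P)
    (by rwa [natDegree_C_mul (by exact_mod_cast hb)]) B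
  refine ⟨n, ?_⟩
  have e : √(D : ℝ) = b * √a := by
    rw [← hab]
    push_cast
    rw [Real.sqrt_mul (by positivity), Real.sqrt_sq (by positivity)]
  rw [eval_mul, eval_C, Rat.cast_mul, Rat.cast_natCast, ← mul_assoc, mul_comm √(a : ℝ), ← e] at hn
  exact hn
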